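/- For every ranked alphabet Σ and every k ≥ 1, every tree language over Σ accepted by a deterministic k-head tree-walking automaton with nested pebbles is definable in first-order logic with k-ary deterministic transitive closure: DPTWA^k ⊆ FO+DTC^k. -/

import Mathlib

namespace NestedPebbles

/-- Trees over a ranked alphabet `(Sig, rank)`: terms `σ(t₁,…,tₙ)` with `rank σ = n`. -/
inductive RTree (Sig : Type) (rank : Sig → ℕ) : Type
  | node (a : Sig) (children : Fin (rank a) → RTree Sig rank) : RTree Sig rank

namespace RTree

variable {Sig : Type} {rank : Sig → ℕ}

/-- The label of the root symbol. -/
def label : RTree Sig rank → Sig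
  | node a _ => a

/-- The `i`-th (0-based) immediate subtree, if it exists. -/
def child : RTree Sig rank → ℕ → Option (RTree Sig rank)
  | node a c, i => if h : i < rank a then some (c ⟨i, h⟩) else none

/-- The subtree at a position (a list of 0-based child indices, read from the root). -/
def subtree : RTree Sig rank → List ℕ → Option (RTree Sig rank)
  | t, [] => some t
  | t, i :: p => (t.child i).bind fun s => s.subtree p

end RTree

variable {Sig : Type} {rank : Sig → ℕ}

/-- `p` is (the address of) a node of `t`. -/
def IsPos (t : RTree Sig rank) (p : List ℕ) : Prop := (t.subtree p).isSome = true

/-- The type of nodes of a tree `t`, as valid positions. -/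
def Pos (t : RTree Sig rank) : Type := { p : List ℕ // IsPos t p }

/-- The root node. -/
def rootPos (t : RTree Sig rank) : Pos t := ⟨[], rfl⟩

/-- The label of the node of `t` at position `p`. -/
def labelAt (t : RTree Sig rank) (p : List ℕ) : Option Sig := (t.subtree p).map RTree.label

/-- The child number of a node: `0` for the root, and `j` for a `j`-th child (1-based). -/
def childNo (p : List ℕ) : ℕ :=
  match p.getLast? with
  | none => 0
  | some j => j + 1

/-!  ### First-order logic with k-ary transitive closure, on trees  -/

/-- First-order formulas over a ranked alphabet, with a `k`-ary transitive closure
operator.  Variables are natural numbers.  `lab a x` means `x` has label `a`;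
`edg i x y` means `y` is the `i`-th child of `x` (`i` is 1-based);
`le x y` means `x` is an ancestor of `y`; `tc xs ys φ us vs` is the transitive
closure `φ*` of `φ` with respect to the tuples of variables `xs`, `ys` (which it
binds), applied to the tuples of variables `us`, `vs`. -/
inductive TForm (Sig : Type) (rank : Sig → ℕ) (k : ℕ) : Type
  | lab (a : Sig) (x : ℕ)
  | edg (i : ℕ) (x y : ℕ)
  | le (x y : ℕ)
  | eq (x y : ℕ)
  | not (φ : TForm Sig rank k)
  | and (φ ψ : TForm Sig rank k)
  | or (φ ψ : TForm Sig rank k)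
  | ex (x : ℕ) (φ : TForm Sig rank k)
  | all (x : ℕ) (φ : TForm Sig rank k)
  | tc (xs ys : Fin k → ℕ) (φ : TForm Sig rank k) (us vs : Fin k → ℕ)

/-- Update a valuation on a tuple of variables simultaneously. -/
noncomputable def updVec {α : Type} {k : ℕ} (ν : ℕ → α) (xs : Fin k → ℕ) (a : Fin k → α) :
    ℕ → α :=
  fun n => if h : ∃ i, xs i = n then a h.choose else ν n

/-- Satisfaction of a formula in a tree `t` under a valuation of the variables by
nodes of `t`. -/
def Sat {k : ℕ} (t : RTree Sig rank) : TForm Sig rank k → (ℕ → Pos t) → Prop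
  | .lab a x, ν => labelAt t (ν x).1 = some a
  | .edg i x y, ν => 1 ≤ i ∧ (ν y).1 = (ν x).1 ++ [i - 1]
  | .le x y, ν => (ν x).1 <+: (ν y).1
  | .eq x y, ν => ν x = ν y
  | .not φ, ν => ¬ Sat t φ ν
  | .and φ ψ, ν => Sat t φ ν ∧ Sat t ψ ν
  | .or φ ψ, ν => Sat t φ ν ∨ Sat t ψ ν
  | .ex x φ, ν => ∃ u : Pos t, Sat t φ (Function.update ν x u)
  | .all x φ, ν => ∀ u : Pos t, Sat t φ (Function.update ν x u)
  | .tc xs ys φ us vs, ν =>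
      Relation.ReflTransGen
        (fun a b : Fin k → Pos t => Sat t φ (updVec (updVec ν xs a) ys b))
        (fun i => ν (us i)) (fun i => ν (vs i))

/-- The free variables of a formula. -/
def freeVars {k : ℕ} : TForm Sig rank k → Set ℕ
  | .lab _ x => {x}
  | .edg _ x y => {x, y}
  | .le x y => {x, y}
  | .eq x y => {x, y}
  | .not φ => freeVars φ
  | .and φ ψ => freeVars φ ∪ freeVars ψ
  | .or φ ψ => freeVars φ ∪ freeVars ψ
  | .ex x φ => freeVars φ \ {x}
  | .all x φ => freeVars φ \ {x}
  | .tc xs ys φ us vs =>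
      (freeVars φ \ (Set.range xs ∪ Set.range ys)) ∪ Set.range us ∪ Set.range vs

/-- Two `k`-tuples of variables consist of `2k` pairwise distinct variables. -/
def Distinct2 {k : ℕ} (xs ys : Fin k → ℕ) : Prop :=
  Function.Injective xs ∧ Function.Injective ys ∧ ∀ i j, xs i ≠ ys j

/-- `φ` is functional in the tuples of variables `xs`, `ys`: for every tree, every
valuation of the remaining variables, and every value of `xs`, there is at most one
value of `ys` satisfying `φ`. -/
def FunctionalIn {k : ℕ} (φ : TForm Sig rank k) (xs ys : Fin k → ℕ) : Prop :=
  ∀ (t : RTree Sig rank) (ν : ℕ → Pos t) (a b b' : Fin k → Pos t),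
    Sat t φ (updVec (updVec ν xs a) ys b) →
    Sat t φ (updVec (updVec ν xs a) ys b') → b = b'

/-- Well-formedness: in each transitive closure the `2k` bound variables are
pairwise distinct and occur free in the body. -/
def WF {k : ℕ} : TForm Sig rank k → Prop
  | .not φ => WF φ
  | .and φ ψ => WF φ ∧ WF ψ
  | .or φ ψ => WF φ ∧ WF ψ
  | .ex _ φ => WF φ
  | .all _ φ => WF φ
  | .tc xs ys φ _ _ =>
      Distinct2 xs ys ∧ (Set.range xs ∪ Set.range ys) ⊆ freeVars φ ∧ WF φ
  | _ => True

/-- All transitive closures occurring in the formula are deterministic, i.e., applied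
to functional formulas. -/
def DetTC {k : ℕ} : TForm Sig rank k → Prop
  | .not φ => DetTC φ
  | .and φ ψ => DetTC φ ∧ DetTC ψ
  | .or φ ψ => DetTC φ ∧ DetTC ψ
  | .ex _ φ => DetTC φ
  | .all _ φ => DetTC φ
  | .tc xs ys φ _ _ => FunctionalIn φ xs ys ∧ DetTC φ
  | _ => True

/-- All occurrences of transitive closure are positive (within the scope of an even
number of negations); the polarity parameter `b` is `true` for an even number. -/
def PosTC {k : ℕ} : Bool → TForm Sig rank k → Prop
  | b, .not φ => PosTC (!b) φ
  | b, .and φ ψ => PosTC b φ ∧ PosTC b ψ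
  | b, .or φ ψ => PosTC b φ ∧ PosTC b ψ
  | b, .ex _ φ => PosTC b φ
  | b, .all _ φ => PosTC b φ
  | b, .tc _ _ φ _ _ => b = true ∧ PosTC b φ
  | _, _ => True

/-- The formula contains no transitive closure operator (pure first-order). -/
def TCFree {k : ℕ} : TForm Sig rank k → Prop
  | .not φ => TCFree φ
  | .and φ ψ => TCFree φ ∧ TCFree ψ
  | .or φ ψ => TCFree φ ∧ TCFree ψ
  | .ex _ φ => TCFree φ
  | .all _ φ => TCFree φ
  | .tc _ _ _ _ _ => False
  | _ => True

/-- The tree language defined by a (closed) formula. -/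
def treesOf {k : ℕ} (φ : TForm Sig rank k) : Set (RTree Sig rank) :=
  {t | Sat t φ fun _ => rootPos t}

/-- `FO+DTC^k`: tree languages definable by closed first-order formulas with `k`-ary
deterministic transitive closure. -/
def FODTC (Sig : Type) (rank : Sig → ℕ) (k : ℕ) : Set (Set (RTree Sig rank)) :=
  {L | ∃ φ : TForm Sig rank k, WF φ ∧ DetTC φ ∧ freeVars φ = ∅ ∧ L = treesOf φ}

/-- `FO+TC^k`: tree languages definable by closed first-order formulas with `k`-ary
transitive closure. -/
def FOTC (Sig : Type) (rank : Sig → ℕ) (k : ℕ) : Set (Set (RTree Sig rank)) :=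
  {L | ∃ φ : TForm Sig rank k, WF φ ∧ freeVars φ = ∅ ∧ L = treesOf φ}

/-- `FO+posTC^k`: tree languages definable by closed first-order formulas in which
every occurrence of the `k`-ary transitive closure operator is positive. -/
def FOposTC (Sig : Type) (rank : Sig → ℕ) (k : ℕ) : Set (Set (RTree Sig rank)) :=
  {L | ∃ φ : TForm Sig rank k, WF φ ∧ PosTC true φ ∧ freeVars φ = ∅ ∧ L = treesOf φ}

/-!  ### k-head tree-walking automata with nested pebbles  -/

/-- Tests of a `k`-head tree-walking automaton with pebble set `X`:
label of the node under head `i`, presence of pebble `x` at head `i`, and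
child number of the node under head `i`. -/
inductive TTest (Sig : Type) (k : ℕ) (X : Type) : Type
  | lab (i : Fin k) (a : Sig)
  | peb (i : Fin k) (x : X)
  | chno (i : Fin k) (j : ℕ)

/-- Instructions: move head `i` up / down to the `j`-th child (1-based), drop a
pebble at head `i`, retrieve the most recently dropped pebble (from a distance),
or perform a positive (`b = true`) or negated (`b = false`) test. -/
inductive TInstr (Sig : Type) (k : ℕ) (X : Type) : Type
  | up (i : Fin k)
  | down (i : Fin k) (j : ℕ)
  | dropPeb (i : Fin k) (x : X)
  | retrieve (x : X)
  | test (b : Bool) (τ : TTest Sig k X)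

/-- A `k`-head tree-walking automaton with nested pebbles: a finite state set `Q`,
a finite pebble set `X`, an initial state, accepting states, and a finite set of
instructions `⟨p, χ, q⟩`. -/
structure TWA (Sig : Type) (rank : Sig → ℕ) (k : ℕ) : Type 1 where
  Q : Type
  finQ : Fintype Q
  X : Type
  finX : Fintype X
  q0 : Q
  acc : Set Q
  instr : Set (Q × TInstr Sig k X × Q)
  instrFin : instr.Finite

/-- Configurations: a state, the positions of the `k` heads, and the stack of
dropped pebbles with their positions (most recent first). -/
abbrev TConf {Sig : Type} {rank : Sig → ℕ} {k : ℕ} (A : TWA Sig rank k)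
    (t : RTree Sig rank) : Type :=
  A.Q × (Fin k → Pos t) × List (A.X × Pos t)

/-- Semantics of tests. -/
def testHolds {k : ℕ} (t : RTree Sig rank) {X : Type} (τ : TTest Sig k X)
    (hs : Fin k → Pos t) (π : List (X × Pos t)) : Prop :=
  match τ with
  | .lab i a => labelAt t (hs i).1 = some a
  | .peb i x => (x, hs i) ∈ π
  | .chno i j => childNo (hs i).1 = j

/-- Semantics of a single instruction, relating head positions and pebble stacks
before and after. -/
def instrStep {k : ℕ} (t : RTree Sig rank) {X : Type} (ins : TInstr Sig k X)
    (hs : Fin k → Pos t) (π : List (X × Pos t))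
    (hs' : Fin k → Pos t) (π' : List (X × Pos t)) : Prop :=
  match ins with
  | .up i => π' = π ∧ (∃ j : ℕ, (hs i).1 = (hs' i).1 ++ [j]) ∧ ∀ h, h ≠ i → hs' h = hs h
  | .down i j => π' = π ∧ 1 ≤ j ∧ (hs' i).1 = (hs i).1 ++ [j - 1] ∧ ∀ h, h ≠ i → hs' h = hs h
  | .dropPeb i x => hs' = hs ∧ π' = (x, hs i) :: π ∧ ∀ w, (x, w) ∉ π
  | .retrieve x => hs' = hs ∧ ∃ w, π = (x, w) :: π'
  | .test b τ => hs' = hs ∧ π' = π ∧ (testHolds t τ hs π ↔ b = true)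

/-- The step relation of automaton `A` on tree `t`. -/
def Step {k : ℕ} (A : TWA Sig rank k) (t : RTree Sig rank) :
    TConf A t → TConf A t → Prop :=
  fun c c' => ∃ ins : TInstr Sig k A.X,
    (c.1, ins, c'.1) ∈ A.instr ∧ instrStep t ins c.2.1 c.2.2 c'.2.1 c'.2.2

/-- `χ'` is the negation of the test `χ`. -/
def negOf {k : ℕ} {X : Type} (χ χ' : TInstr Sig k X) : Prop :=
  ∃ b τ, χ = TInstr.test b τ ∧ χ' = TInstr.test (!b) τ

/-- Determinism: any two distinct instructions with the same source state consist
of a test and its negation. -/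
def Deterministic {k : ℕ} (A : TWA Sig rank k) : Prop :=
  ∀ p χ₁ q₁ χ₂ q₂, (p, χ₁, q₁) ∈ A.instr → (p, χ₂, q₂) ∈ A.instr →
    (χ₁, q₁) ≠ (χ₂, q₂) → negOf χ₁ χ₂ ∨ negOf χ₂ χ₁

/-- The initial configuration: initial state, all heads at the root, no pebbles. -/
def initConf {k : ℕ} (A : TWA Sig rank k) (t : RTree Sig rank) : TConf A t :=
  (A.q0, fun _ => rootPos t, [])

/-- A configuration is halting if no step is possible from it. -/
def HaltingConf {k : ℕ} (A : TWA Sig rank k) (t : RTree Sig rank) (c : TConf A t) : Prop :=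
  ∀ c', ¬ Step A t c c'

/-- Acceptance: some computation from the initial configuration halts in an
accepting state with all heads at the root and no pebbles on the tree. -/
def Accepts {k : ℕ} (A : TWA Sig rank k) (t : RTree Sig rank) : Prop :=
  ∃ q ∈ A.acc,
    Relation.ReflTransGen (Step A t) (initConf A t) (q, fun _ => rootPos t, []) ∧
    HaltingConf A t (q, fun _ => rootPos t, [])

/-- The tree language accepted by `A`. -/
def Lang {k : ℕ} (A : TWA Sig rank k) : Set (RTree Sig rank) := {t | Accepts A t}

/-- The automaton uses no pebbles at all. -/
def PebbleFree {k : ℕ} (A : TWA Sig rank k) : Prop :=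
  ∀ p χ q, (p, χ, q) ∈ A.instr →
    (∀ i x, χ ≠ TInstr.dropPeb i x) ∧ (∀ x, χ ≠ TInstr.retrieve x) ∧
    (∀ b i x, χ ≠ TInstr.test b (TTest.peb i x))

/-- `DPTWA^k`: tree languages accepted by deterministic `k`-head tree-walking
automata with nested pebbles. -/
def DPTWA (Sig : Type) (rank : Sig → ℕ) (k : ℕ) : Set (Set (RTree Sig rank)) :=
  {L | ∃ A : TWA Sig rank k, Deterministic A ∧ L = Lang A}

/-- `NPTWA^k`: tree languages accepted by nondeterministic `k`-head tree-walking
automata with nested pebbles. -/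
def NPTWA (Sig : Type) (rank : Sig → ℕ) (k : ℕ) : Set (Set (RTree Sig rank)) :=
  {L | ∃ A : TWA Sig rank k, L = Lang A}

/-- `NTWA^k`: tree languages accepted by nondeterministic `k`-head tree-walking
automata without pebbles. -/
def NTWA (Sig : Type) (rank : Sig → ℕ) (k : ℕ) : Set (Set (RTree Sig rank)) :=
  {L | ∃ A : TWA Sig rank k, PebbleFree A ∧ L = Lang A}

end NestedPebbles

namespace NestedPebbles

section Definability

variable {k : ℕ}

/-- A predicate on valuations of `ι` is definable, uniformly in the choice of variables. -/
def Dfn (k : ℕ) {ι : Type} (P : ∀ t : RTree Sig rank, (ι → Pos t) → Prop) : Prop :=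
  ∀ v : ι → ℕ, ∃ φ : TForm Sig rank k, WF φ ∧ DetTC φ ∧ freeVars φ ⊆ Set.range v ∧
    ∀ t ν, Sat t φ ν ↔ P t (fun i => ν (v i))

theorem Dfn.congr {ι : Type} {P Q : ∀ t : RTree Sig rank, (ι → Pos t) → Prop}
    (h : Dfn k P) (e : ∀ t f, Q t f ↔ P t f) : Dfn k Q := by
  intro v
  obtain ⟨φ, h1, h2, h3, h4⟩ := h v
  exact ⟨φ, h1, h2, h3, fun t ν => by rw [h4, e]⟩

theorem Dfn.reindex {ι κ : Type} {P : ∀ t : RTree Sig rank, (ι → Pos t) → Prop}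
    (h : Dfn k P) (g : ι → κ) :
    Dfn k (fun t (f : κ → Pos t) => P t (fun i => f (g i))) := by
  intro v
  obtain ⟨φ, h1, h2, h3, h4⟩ := h (fun i => v (g i))
  refine ⟨φ, h1, h2, h3.trans ?_, fun t ν => h4 t ν⟩
  rintro _ ⟨i, rfl⟩
  exact ⟨g i, rfl⟩

theorem Dfn.and {ι : Type} {P Q : ∀ t : RTree Sig rank, (ι → Pos t) → Prop}
    (h : Dfn k P) (h' : Dfn k Q) : Dfn k (fun t f => P t f ∧ Q t f) := by
  intro v
  obtain ⟨φ, h1, h2, h3, h4⟩ := h v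
  obtain ⟨φ', h1', h2', h3', h4'⟩ := h' v
  exact ⟨.and φ φ', ⟨h1, h1'⟩, ⟨h2, h2'⟩, Set.union_subset h3 h3', fun t ν => by
    simp only [Sat, h4, h4']⟩

theorem Dfn.or {ι : Type} {P Q : ∀ t : RTree Sig rank, (ι → Pos t) → Prop}
    (h : Dfn k P) (h' : Dfn k Q) : Dfn k (fun t f => P t f ∨ Q t f) := by
  intro v
  obtain ⟨φ, h1, h2, h3, h4⟩ := h v
  obtain ⟨φ', h1', h2', h3', h4'⟩ := h' v
  exact ⟨.or φ φ', ⟨h1, h1'⟩, ⟨h2, h2'⟩, Set.union_subset h3 h3', fun t ν => by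
    simp only [Sat, h4, h4']⟩

theorem Dfn.not {ι : Type} {P : ∀ t : RTree Sig rank, (ι → Pos t) → Prop}
    (h : Dfn k P) : Dfn k (fun t f => ¬ P t f) := by
  intro v
  obtain ⟨φ, h1, h2, h3, h4⟩ := h v
  exact ⟨.not φ, h1, h2, h3, fun t ν => by simp only [Sat, h4]⟩

theorem Dfn.true {ι : Type} :
    Dfn k (fun (t : RTree Sig rank) (_ : ι → Pos t) => True) := by
  intro v
  refine ⟨.all 0 (.eq 0 0), trivial, trivial, ?_, fun t ν => ?_⟩
  · simp [freeVars]
  · simp [Sat]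

theorem Dfn.const {ι : Type} (p : Prop) :
    Dfn k (fun (t : RTree Sig rank) (_ : ι → Pos t) => p) := by
  by_cases hp : p
  · exact Dfn.true.congr (fun t f => by simp [hp])
  · exact Dfn.true.not.congr (fun t f => by simp [hp])

theorem Dfn.lab {ι : Type} (a : Sig) (i : ι) :
    Dfn k (fun (t : RTree Sig rank) (f : ι → Pos t) => labelAt t (f i).1 = some a) := by
  intro v
  refine ⟨.lab a (v i), trivial, trivial, ?_, fun t ν => Iff.rfl⟩
  rintro _ rfl
  exact ⟨i, rfl⟩

theorem Dfn.edg {ι : Type} (n : ℕ) (i j : ι) :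
    Dfn k (fun (t : RTree Sig rank) (f : ι → Pos t) =>
      1 ≤ n ∧ (f j).1 = (f i).1 ++ [n - 1]) := by
  intro v
  refine ⟨.edg n (v i) (v j), trivial, trivial, ?_, fun t ν => Iff.rfl⟩
  rintro _ (rfl | rfl)
  exacts [⟨i, rfl⟩, ⟨j, rfl⟩]

theorem Dfn.le {ι : Type} (i j : ι) :
    Dfn k (fun (t : RTree Sig rank) (f : ι → Pos t) => (f i).1 <+: (f j).1) := by
  intro v
  refine ⟨.le (v i) (v j), trivial, trivial, ?_, fun t ν => Iff.rfl⟩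
  rintro _ (rfl | rfl)
  exacts [⟨i, rfl⟩, ⟨j, rfl⟩]

theorem Dfn.eq {ι : Type} (i j : ι) :
    Dfn k (fun (t : RTree Sig rank) (f : ι → Pos t) => f i = f j) := by
  intro v
  refine ⟨.eq (v i) (v j), trivial, trivial, ?_, fun t ν => Iff.rfl⟩
  rintro _ (rfl | rfl)
  exacts [⟨i, rfl⟩, ⟨j, rfl⟩]

theorem exists_fresh {ι : Type} [Finite ι] (v : ι → ℕ) : ∃ N, ∀ i, v i < N := by
  obtain ⟨N, hN⟩ := (Set.finite_range v).bddAbove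
  exact ⟨N + 1, fun i => Nat.lt_succ_of_le (hN ⟨i, rfl⟩)⟩

theorem Dfn.ex {ι : Type} [Finite ι] {P : ∀ t : RTree Sig rank, (Option ι → Pos t) → Prop}
    (h : Dfn k P) :
    Dfn k (fun t (f : ι → Pos t) => ∃ u : Pos t, P t (fun o => o.elim u f)) := by
  intro v
  obtain ⟨N, hN⟩ := exists_fresh v
  obtain ⟨φ, h1, h2, h3, h4⟩ := h (fun o => o.elim N v)
  refine ⟨.ex N φ, h1, h2, ?_, fun t ν => ?_⟩
  · rintro n ⟨hn, hn'⟩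
    obtain ⟨o, rfl⟩ := h3 hn
    cases o with
    | none => exact absurd rfl hn'
    | some i => exact ⟨i, rfl⟩
  · simp only [Sat, h4]
    refine exists_congr fun u => ?_
    have : (fun i : Option ι => Function.update ν N u (i.elim N v)) =
        fun o => o.elim u (fun i => ν (v i)) := by
      funext o
      cases o with
      | none => simp
      | some i => simp [Function.update_of_ne (hN i).ne]
    rw [this]

theorem Dfn.exVec (n : ℕ) : ∀ {ι : Type} [Finite ι]
    {P : ∀ t : RTree Sig rank, (Fin n ⊕ ι → Pos t) → Prop},
    Dfn k P → Dfn k (fun t (f : ι → Pos t) => ∃ g : Fin n → Pos t, P t (Sum.elim g f)) := by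
  induction n with
  | zero =>
    intro ι _ P h
    refine (h.reindex (Sum.elim (fun i : Fin 0 => i.elim0) id)).congr fun t f => ?_
    have : ∀ g : Fin 0 → Pos t, Sum.elim g f =
        fun i => f (Sum.elim (fun i : Fin 0 => i.elim0) id i) := by
      intro g; funext i; rcases i with i | i
      · exact i.elim0
      · rfl
    simp [this]
  | succ n ih =>
    intro ι _ P h
    have h2 := (ih (h.reindex (κ := Fin n ⊕ Option ι)
      (Sum.elim (Fin.cases (Sum.inr none) Sum.inl) (fun j => Sum.inr (some j))))).ex
    refine h2.congr fun t f => ?_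
    rw [Fin.exists_fin_succ_pi]
    refine exists_congr fun u => exists_congr fun g => ?_
    have : Sum.elim (Fin.cons u g : Fin (n+1) → Pos t) f = fun i => Sum.elim g (fun o : Option ι => o.elim u f)
        (Sum.elim (Fin.cases (Sum.inr none) Sum.inl) (fun j => Sum.inr (some j)) i) := by
      funext i
      rcases i with i | i
      · refine Fin.cases ?_ (fun i => ?_) i <;> simp
      · rfl
    rw [← this]

theorem Dfn.exFin {ι σ : Type} {S : Set σ} (hS : S.Finite)
    {P : σ → ∀ t : RTree Sig rank, (ι → Pos t) → Prop} (h : ∀ s ∈ S, Dfn k (P s)) :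
    Dfn k (fun t f => ∃ s ∈ S, P s t f) := by
  induction S, hS using Set.Finite.induction_on with
  | empty => exact (Dfn.const False).congr (by simp)
  | @insert a s _ _ ih =>
    refine ((h a (by simp)).or (ih (fun s hs => h s (by simp [hs])))).congr fun t f => ?_
    simp

theorem Dfn.allFin {ι σ : Type} {S : Set σ} (hS : S.Finite)
    {P : σ → ∀ t : RTree Sig rank, (ι → Pos t) → Prop} (h : ∀ s ∈ S, Dfn k (P s)) :
    Dfn k (fun t f => ∀ s ∈ S, P s t f) := by
  refine (Dfn.exFin hS (fun s hs => (h s hs).not)).not.congr fun t f => ?_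
  push Not; rfl

theorem updVec_apply {α : Type} {ν : ℕ → α} {xs : Fin k → ℕ} (hx : Function.Injective xs)
    (a : Fin k → α) (i : Fin k) : updVec ν xs a (xs i) = a i := by
  unfold updVec
  have h : ∃ j, xs j = xs i := ⟨i, rfl⟩
  rw [dif_pos h]
  exact congrArg a (hx h.choose_spec)

theorem updVec_ne {α : Type} {ν : ℕ → α} {xs : Fin k → ℕ}
    (a : Fin k → α) {n : ℕ} (hn : ∀ i, xs i ≠ n) : updVec ν xs a n = ν n := by
  unfold updVec
  rw [dif_neg (by rintro ⟨i, hi⟩; exact hn i hi)]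

/-- A formula true everywhere whose free variables are those in `l`. -/
def trueOn (Sig : Type) (rank : Sig → ℕ) (k : ℕ) : List ℕ → TForm Sig rank k
  | [] => .all 0 (.eq 0 0)
  | n :: l => .and (.eq n n) (trueOn Sig rank k l)

theorem trueOn_spec (l : List ℕ) : WF (trueOn Sig rank k l) ∧ DetTC (trueOn Sig rank k l) ∧
    freeVars (trueOn Sig rank k l) = {n | n ∈ l} ∧
    ∀ t ν, Sat t (trueOn Sig rank k l) ν := by
  induction l with
  | nil => simp [trueOn, WF, DetTC, freeVars, Sat]
  | cons n l ih =>
    obtain ⟨h1, h2, h3, h4⟩ := ih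
    refine ⟨⟨trivial, h1⟩, ⟨trivial, h2⟩, ?_, fun t ν => ⟨rfl, h4 t ν⟩⟩
    simp only [trueOn, freeVars, h3]
    ext m; simp

theorem Dfn.tc {ι : Type} [Finite ι]
    {P : ∀ t : RTree Sig rank, (ι ⊕ (Fin k ⊕ Fin k) → Pos t) → Prop} (h : Dfn k P)
    (hf : ∀ t f a b b', P t (Sum.elim f (Sum.elim a b)) → P t (Sum.elim f (Sum.elim a b')) →
      b = b') :
    Dfn k (fun t (g : ι ⊕ (Fin k ⊕ Fin k) → Pos t) =>
      Relation.ReflTransGen (fun a b => P t (Sum.elim (fun i => g (.inl i)) (Sum.elim a b)))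
        (fun i => g (.inr (.inl i))) (fun i => g (.inr (.inr i)))) := by
  intro v
  obtain ⟨N, hN⟩ := exists_fresh v
  let xs : Fin k → ℕ := fun i => N + i
  let ys : Fin k → ℕ := fun i => N + k + i
  have hxs : Function.Injective xs := fun i j h => by
    apply Fin.ext; simp only [xs] at h; omega
  have hys : Function.Injective ys := fun i j h => by
    apply Fin.ext; simp only [ys] at h; omega
  have hxy : ∀ i j, xs i ≠ ys j := fun i j => by
    simp only [xs, ys]; omega
  have hvx : ∀ i j, xs i ≠ v j := fun i j => by
    have := hN j; simp only [xs]; omega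
  have hvy : ∀ i j, ys i ≠ v j := fun i j => by
    have := hN j; simp only [ys]; omega
  obtain ⟨φ, h1, h2, h3, h4⟩ :=
    h (Sum.elim (fun i => v (.inl i)) (Sum.elim xs ys))
  obtain ⟨g1, g2, g3, g4⟩ :=
    trueOn_spec (Sig := Sig) (rank := rank) (k := k) (List.ofFn xs ++ List.ofFn ys)
  have key : ∀ t (ν : ℕ → Pos t) a b,
      Sat t (.and φ (trueOn Sig rank k (List.ofFn xs ++ List.ofFn ys)))
        (updVec (updVec ν xs a) ys b) ↔
      P t (Sum.elim (fun i => ν (v (.inl i))) (Sum.elim a b)) := by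
    intro t ν a b
    simp only [Sat, g4, and_true, h4]
    apply iff_of_eq
    congr 1
    funext i
    rcases i with i | i | i
    · simp only [Sum.elim_inl]
      rw [updVec_ne _ (fun j => hvy j _), updVec_ne _ (fun j => hvx j _)]
    · simp only [Sum.elim_inl, Sum.elim_inr]
      rw [updVec_ne _ (fun j => (hxy _ j).symm), updVec_apply hxs]
    · simp only [Sum.elim_inr]
      rw [updVec_apply hys]
  refine ⟨.tc xs ys (.and φ (trueOn Sig rank k (List.ofFn xs ++ List.ofFn ys)))
    (fun i => v (.inr (.inl i))) (fun i => v (.inr (.inr i))), ?_, ?_, ?_, ?_⟩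
  · refine ⟨⟨hxs, hys, hxy⟩, ?_, h1, g1⟩
    simp only [freeVars, g3]
    rintro n (⟨i, rfl⟩ | ⟨i, rfl⟩)
    · exact Or.inr (by simp)
    · exact Or.inr (by simp)
  · refine ⟨?_, h2, g2⟩
    intro t ν a b b' hb hb'
    exact hf t _ a b b' ((key t ν a b).1 hb) ((key t ν a b').1 hb')
  · simp only [freeVars, g3]
    rintro n ((⟨hn | hn, hn'⟩ | ⟨i, rfl⟩) | ⟨i, rfl⟩)
    · obtain ⟨i, rfl⟩ := h3 hn
      rcases i with i | i | i
      · exact ⟨_, rfl⟩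
      · exact absurd (Or.inl ⟨i, rfl⟩) hn'
      · exact absurd (Or.inr ⟨i, rfl⟩) hn'
    · exact absurd (by simpa [List.mem_ofFn] using hn) hn'
    · exact ⟨_, rfl⟩
    · exact ⟨_, rfl⟩
  · intro t ν
    simp only [Sat.eq_10, key]

/-- Definability of binary relations on `k`-tuples with parameters in `X`. -/
def DfnR {X : Type}
    (R : ∀ t : RTree Sig rank, (X → Pos t) → (Fin k → Pos t) → (Fin k → Pos t) → Prop) : Prop :=
  Dfn k (fun t (g : X ⊕ (Fin k ⊕ Fin k) → Pos t) =>
    R t (fun i => g (.inl i)) (fun i => g (.inr (.inl i))) (fun i => g (.inr (.inr i))))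

theorem DfnR.congr {X : Type}
    {R R' : ∀ t : RTree Sig rank, (X → Pos t) → (Fin k → Pos t) → (Fin k → Pos t) → Prop}
    (h : DfnR R) (e : ∀ t f a b, R' t f a b ↔ R t f a b) : DfnR R' :=
  Dfn.congr h (fun t _ => e t _ _ _)

theorem DfnR.comp {X : Type} [Finite X]
    {R R' : ∀ t : RTree Sig rank, (X → Pos t) → (Fin k → Pos t) → (Fin k → Pos t) → Prop}
    (h : DfnR R) (h' : DfnR R') : DfnR (fun t f a b => ∃ c, R t f a c ∧ R' t f c b) := by
  have h1 := Dfn.reindex (κ := Fin k ⊕ (X ⊕ (Fin k ⊕ Fin k))) h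
    (Sum.elim (fun i => .inr (.inl i))
      (Sum.elim (fun i => .inr (.inr (.inl i))) (fun i => .inl i)))
  have h2 := Dfn.reindex (κ := Fin k ⊕ (X ⊕ (Fin k ⊕ Fin k))) h'
    (Sum.elim (fun i => .inr (.inl i))
      (Sum.elim (fun i => .inl i) (fun i => .inr (.inr (.inr i)))))
  exact (Dfn.exVec k (h1.and h2)).congr fun t f => Iff.rfl

theorem DfnR.star {X : Type} [Finite X]
    {R : ∀ t : RTree Sig rank, (X → Pos t) → (Fin k → Pos t) → (Fin k → Pos t) → Prop}
    (h : DfnR R) (hf : ∀ t f a b b', R t f a b → R t f a b' → b = b') :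
    DfnR (fun t f a b => Relation.ReflTransGen (R t f) a b) :=
  Dfn.tc h (fun t f a b b' => hf t f a b b')

theorem IsPos.of_append {t : RTree Sig rank} {p q : List ℕ} (h : IsPos t (p ++ q)) :
    IsPos t p := by
  induction p generalizing t with
  | nil => rfl
  | cons i p ih =>
    unfold IsPos at *
    simp only [List.cons_append, RTree.subtree] at *
    cases hc : t.child i with
    | none => simp [hc] at h
    | some s =>
      simp only [hc, Option.bind_some] at *
      exact ih h

theorem Dfn.root {ι : Type} [Finite ι] (i : ι) :
    Dfn k (fun (t : RTree Sig rank) (f : ι → Pos t) => f i = rootPos t) := by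
  refine (Dfn.ex (Dfn.le (some i) none).not).not.congr fun t f => ?_
  simp only [Option.elim, not_exists, not_not]
  constructor
  · rintro h u
    rw [h]; exact List.nil_prefix
  · intro h
    have := h (rootPos t)
    exact Subtype.ext (List.prefix_nil.1 this)

theorem Dfn.parent {ι : Type} [Finite ι] (i i' : ι) :
    Dfn k (fun (t : RTree Sig rank) (f : ι → Pos t) => ∃ j : ℕ, (f i).1 = (f i').1 ++ [j]) := by
  refine ((Dfn.le i' i).and ((Dfn.eq i i').not.and (Dfn.ex ((Dfn.le none (some i)).and
    ((Dfn.le none (some i')).not.and (Dfn.eq none (some i)).not))).not)).congr fun t f => ?_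
  simp only [Option.elim]
  constructor
  · rintro ⟨j, hj⟩
    refine ⟨⟨[j], hj.symm⟩, fun h => ?_, ?_⟩
    · rw [h] at hj; simp at hj
    · rintro ⟨u, hu, hu', hne⟩
      rw [hj, List.prefix_concat_iff] at hu
      rcases hu with hu | hu
      · exact hne (Subtype.ext (hu.trans hj.symm))
      · exact hu' hu
  · rintro ⟨⟨r, hr⟩, hne, hn⟩
    cases r with
    | nil => exact absurd (Subtype.ext (by simpa using hr.symm)) hne
    | cons j r =>
      have hp : IsPos t ((f i').1 ++ [j]) := by
        apply IsPos.of_append (q := r)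
        simpa [hr] using (f i).2
      by_contra hcon
      refine hn ⟨⟨_, hp⟩, ⟨r, by simpa using hr⟩, ?_, ?_⟩
      · intro h
        have := h.length_le
        simp at this
      · intro h
        exact hcon ⟨j, by rw [← h]⟩

theorem Dfn.chno {ι : Type} [Finite ι] (i : ι) (j : ℕ) :
    Dfn k (fun (t : RTree Sig rank) (f : ι → Pos t) => childNo (f i).1 = j) := by
  cases j with
  | zero =>
    refine (Dfn.root i).congr fun t f => ?_
    rw [show (f i = rootPos t) ↔ (f i).1 = [] from Subtype.ext_iff]
    unfold childNo
    cases h : (f i).1.getLast? with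
    | none => simpa using h
    | some j => simp only [Nat.add_eq_zero_iff, one_ne_zero, and_false, false_iff]; rintro h'; simp [h'] at h
  | succ j =>
    refine (Dfn.ex (Dfn.edg (j+1) none (some i))).congr fun t f => ?_
    simp only [Option.elim, Nat.add_sub_cancel]
    unfold childNo
    constructor
    · intro h
      rcases List.eq_nil_or_concat (f i).1 with h' | ⟨l, b, h'⟩
      · simp [h'] at h
      · rw [List.concat_eq_append] at h'
        simp only [h', List.getLast?_append, List.getLast?_singleton, Option.some_or] at h
        refine ⟨⟨l, IsPos.of_append (q := [b]) (h' ▸ (f i).2)⟩, by omega, ?_⟩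
        change _ = l ++ [j]
        rw [h']
        simp at h
        rw [h]
    · rintro ⟨u, -, hu⟩
      simp [hu]

end Definability

section FirstHit

variable {C : Type} {step : C → C → Prop}

/-- `d` is the first configuration in `S` reached from `c` by at least one step. -/
inductive FH (step : C → C → Prop) (S : C → Prop) : C → C → Prop
  | one {c d} : step c d → S d → FH step S c d
  | cons {c e d} : step c e → ¬ S e → FH step S e d → FH step S c d

theorem FH.target {S : C → Prop} {c d} (h : FH step S c d) : S d := by
  induction h with
  | one _ h => exact h
  | cons _ _ _ ih => exact ih

theorem FH.functional (hdet : ∀ c d d', step c d → step c d' → d = d') {S : C → Prop} {c d d'}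
    (h : FH step S c d) (h' : FH step S c d') : d = d' := by
  induction h with
  | one h1 h2 =>
    cases h' with
    | one g1 g2 => exact hdet _ _ _ h1 g1
    | cons g1 g2 g3 => exact absurd (hdet _ _ _ h1 g1 ▸ h2) g2
  | cons h1 h2 h3 ih =>
    cases h' with
    | one g1 g2 => exact absurd (hdet _ _ _ h1 g1 ▸ g2) h2
    | cons g1 g2 g3 => exact ih (hdet _ _ _ h1 g1 ▸ g3)

theorem FH.congr {S S' : C → Prop} (h : ∀ c, S c ↔ S' c) {c d} :
    FH step S c d ↔ FH step S' c d := by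
  have : S = S' := funext fun c => propext (h c)
  rw [this]

theorem FH.trans {S S' : C → Prop} (hs : ∀ c, S' c → S c) {c e d} (h : FH step S c e)
    (he : ¬ S' e) (h' : FH step S' e d) : FH step S' c d := by
  induction h with
  | one h1 _ => exact .cons h1 he h'
  | cons h1 h2 _ ih => exact .cons h1 (fun h => h2 (hs _ h)) (ih he h')

theorem FH.elim_iff {S S' : C → Prop} (hs : ∀ c, S' c → S c) {c d} :
    FH step S' c d ↔ S' d ∧ ∃ e, Relation.ReflTransGen
      (fun a b => FH step S a b ∧ ¬ S' b) c e ∧ FH step S e d := by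
  constructor
  · intro h
    refine ⟨h.target, ?_⟩
    induction h with
    | one h1 h2 => exact ⟨_, .refl, .one h1 (hs _ h2)⟩
    | @cons c e d h1 h2 h3 ih =>
      obtain ⟨e', g1, g2⟩ := ih
      by_cases hse : S e
      · exact ⟨e', .head ⟨.one h1 hse, h2⟩ g1, g2⟩
      · rcases Relation.ReflTransGen.cases_head g1 with rfl | ⟨g, ⟨k1, k2⟩, k3⟩
        · exact ⟨c, .refl, .cons h1 hse g2⟩
        · exact ⟨e', .head ⟨.cons h1 hse k1, k2⟩ k3, g2⟩
  · rintro ⟨hd, e, h1, h2⟩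
    induction h1 using Relation.ReflTransGen.head_induction_on with
    | refl =>
      induction h2 with
      | one g1 g2 => exact .one g1 hd
      | cons g1 g2 _ ih => exact .cons g1 (fun h => g2 (hs _ h)) (ih hd)
    | head g1 _ ih => exact FH.trans hs g1.1 g1.2 ih

theorem FH.reach_iff {S I : C → Prop} (hs : ∀ c, ¬ S c → I c) {c d} (hd : S d) :
    Relation.ReflTransGen (fun a b => step a b ∧ I b) c d ↔
    Relation.ReflTransGen (fun a b => FH step S a b ∧ I b) c d := by
  constructor
  · intro h
    induction h using Relation.ReflTransGen.head_induction_on with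
    | refl => exact .refl
    | @head c e g1 _ ih =>
      by_cases hse : S e
      · exact .head ⟨.one g1.1 hse, g1.2⟩ ih
      · rcases Relation.ReflTransGen.cases_head ih with rfl | ⟨g, ⟨k1, k2⟩, k3⟩
        · exact absurd hd hse
        · exact .head ⟨.cons g1.1 hse k1, k2⟩ k3
  · intro h
    have aux : ∀ a b, FH step S a b → I b →
        Relation.ReflTransGen (fun a b => step a b ∧ I b) a b := by
      intro a b hab hb
      induction hab with
      | one g1 _ => exact .single ⟨g1, hb⟩
      | cons g1 g2 _ ih => exact .head ⟨g1, hs _ g2⟩ (ih hb)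
    clear hd
    induction h with
    | refl => exact .refl
    | tail _ g ih => exact ih.trans (aux _ _ g.1 g.2)

end FirstHit

section Automaton

variable {k : ℕ}

theorem step_det {A : TWA Sig rank k} (hA : Deterministic A) (t : RTree Sig rank)
    (c d d' : TConf A t) (h : Step A t c d) (h' : Step A t c d') : d = d' := by
  obtain ⟨p, a, π⟩ := c
  obtain ⟨q, b, ρ⟩ := d
  obtain ⟨q', b', ρ'⟩ := d'
  obtain ⟨ins, hi, hs⟩ := h
  obtain ⟨ins', hi', hs'⟩ := h'
  simp only at hi hi' hs hs'
  by_cases heq : (ins, q) = (ins', q')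
  · obtain ⟨rfl, rfl⟩ := Prod.mk.inj heq
    suffices b = b' ∧ ρ = ρ' by rw [this.1, this.2]
    cases ins with
    | up i =>
      obtain ⟨rfl, ⟨j, hj⟩, h3⟩ := hs
      obtain ⟨rfl, ⟨j', hj'⟩, h3'⟩ := hs'
      refine ⟨funext fun h => ?_, rfl⟩
      by_cases hh : h = i
      · subst hh
        rw [hj] at hj'
        exact Subtype.ext (List.append_inj_left' hj' rfl)
      · rw [h3 h hh, h3' h hh]
    | down i j =>
      obtain ⟨rfl, -, hj, h3⟩ := hs
      obtain ⟨rfl, -, hj', h3'⟩ := hs'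
      refine ⟨funext fun h => ?_, rfl⟩
      by_cases hh : h = i
      · subst hh
        exact Subtype.ext (hj.trans hj'.symm)
      · rw [h3 h hh, h3' h hh]
    | dropPeb i x =>
      obtain ⟨rfl, rfl, -⟩ := hs
      obtain ⟨rfl, rfl, -⟩ := hs'
      exact ⟨rfl, rfl⟩
    | retrieve x =>
      obtain ⟨rfl, w, rfl⟩ := hs
      obtain ⟨rfl, w', hw⟩ := hs'
      exact ⟨rfl, (List.cons.inj hw).2⟩
    | test b τ =>
      obtain ⟨rfl, rfl, -⟩ := hs
      obtain ⟨rfl, rfl, -⟩ := hs'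
      exact ⟨rfl, rfl⟩
  · exfalso
    rcases hA _ _ _ _ _ hi hi' heq with ⟨b, τ, rfl, rfl⟩ | ⟨b, τ, rfl, rfl⟩
    · have h1 := hs.2.2
      have h2 := hs'.2.2
      cases b <;> simp at h1 h2 <;> contradiction
    · have h1 := hs.2.2
      have h2 := hs'.2.2
      cases b <;> simp at h1 h2 <;> contradiction

/-- The pebble stack with pebbles `w` placed according to `f`. -/
def stk {X : Type} {t : RTree Sig rank} (w : List X) (f : X → Pos t) : List (X × Pos t) :=
  w.map fun x => (x, f x)

/-- Configurations below the stack `π`, or at `π` with a state outside `l`. -/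
def SS {A : TWA Sig rank k} {t : RTree Sig rank} (π : List (A.X × Pos t)) (l : List A.Q) :
    TConf A t → Prop :=
  fun c => ¬ π <:+ c.2.2 ∨ (c.2.2 = π ∧ c.1 ∉ l)

def Reach (A : TWA Sig rank k) (w : List A.X) (p q : A.Q) (t : RTree Sig rank)
    (f : A.X → Pos t) (a b : Fin k → Pos t) : Prop :=
  Relation.ReflTransGen (fun c d : TConf A t => Step A t c d ∧ stk w f <:+ d.2.2)
    (p, a, stk w f) (q, b, stk w f)

def KK (A : TWA Sig rank k) (w : List A.X) (l : List A.Q) (p q : A.Q) (t : RTree Sig rank)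
    (f : A.X → Pos t) (a b : Fin k → Pos t) : Prop :=
  FH (Step A t) (SS (stk w f) l) (p, a, stk w f) (q, b, stk w f)

theorem rtg_tuple {Q H P : Type} {rel : Q × H × P → Q × H × P → Prop} {q : Q} {π : P}
    {c d : Q × H × P} :
    Relation.ReflTransGen (fun c d => rel c d ∧ d.1 = q ∧ d.2.2 = π) c d ↔
    c = d ∨ ∃ a b, rel c (q, a, π) ∧
      Relation.ReflTransGen (fun a b => rel (q, a, π) (q, b, π)) a b ∧ d = (q, b, π) := by
  constructor
  · intro h
    induction h with
    | refl => exact Or.inl rfl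
    | @tail e d _ hs ih =>
      right
      obtain ⟨q', b, π'⟩ := d
      obtain ⟨hs, rfl, rfl⟩ := hs
      simp only at *
      rcases ih with rfl | ⟨a, b', h1, h2, rfl⟩
      · exact ⟨b, b, hs, .refl, rfl⟩
      · exact ⟨a, b, h1, h2.tail hs, rfl⟩
  · rintro (rfl | ⟨a, b, h1, h2, rfl⟩)
    · exact .refl
    · refine .head ⟨h1, rfl, rfl⟩ ?_
      clear h1
      induction h2 with
      | refl => exact .refl
      | tail _ g ih => exact ih.tail ⟨g, rfl, rfl⟩

theorem KK_functional {A : TWA Sig rank k} (hA : Deterministic A) {w l p q t f a b b'}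
    (h : KK A w l p q t f a b) (h' : KK A w l p q t f a b') : b = b' := by
  have := FH.functional (step_det hA t) h h'
  exact (Prod.mk.inj (Prod.mk.inj this).2).1

theorem KK_cons {A : TWA Sig rank k} {w l m p q} (hm : m ∉ l) (hq : q ∉ m :: l) {t f a b} :
    KK A w (m :: l) p q t f a b ↔ KK A w l p q t f a b ∨
      ∃ c, KK A w l p m t f a c ∧ ∃ d, Relation.ReflTransGen (KK A w l m m t f) c d ∧
        KK A w l m q t f d b := by
  have hsub : ∀ c : TConf A t, SS (stk w f) (m :: l) c → SS (stk w f) l c := by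
    rintro c (h | ⟨h1, h2⟩)
    · exact Or.inl h
    · exact Or.inr ⟨h1, fun h => h2 (List.mem_cons_of_mem _ h)⟩
  have hrel : (fun c d : TConf A t => FH (Step A t) (SS (stk w f) l) c d ∧
      ¬ SS (stk w f) (m :: l) d) =
      fun c d => FH (Step A t) (SS (stk w f) l) c d ∧ d.1 = m ∧ d.2.2 = stk w f := by
    funext c d
    apply propext
    refine and_congr_right fun h => ?_
    have h1 := h.target
    constructor
    · intro h2
      rcases h1 with h1 | ⟨h1, h3⟩
      · exact absurd (Or.inl h1) h2
      · refine ⟨?_, h1⟩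
        by_contra hne
        exact h2 (Or.inr ⟨h1, by simp [hne, h3]⟩)
    · rintro ⟨h2, h3⟩ (h4 | ⟨-, h4⟩)
      · exact h4 (by rw [h3])
      · exact h4 (by simp [h2])
  unfold KK
  rw [FH.elim_iff hsub, hrel]
  constructor
  · rintro ⟨-, e, h1, h2⟩
    rcases rtg_tuple.1 h1 with rfl | ⟨c, d, g1, g2, rfl⟩
    · exact Or.inl h2
    · exact Or.inr ⟨c, g1, d, g2, h2⟩
  · intro h
    refine ⟨Or.inr ⟨rfl, hq⟩, ?_⟩
    rcases h with h | ⟨c, g1, d, g2, h2⟩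
    · exact ⟨_, .refl, h⟩
    · exact ⟨_, rtg_tuple.2 (Or.inr ⟨c, d, g1, g2, rfl⟩), h2⟩

theorem Reach_iff {A : TWA Sig rank k} {w l p q} (hl : ∀ r, r ∉ l ↔ r = q) {t f a b} :
    Reach A w p q t f a b ↔ (p = q ∧ a = b) ∨
      ∃ c, KK A w l p q t f a c ∧ Relation.ReflTransGen (KK A w l q q t f) c b := by
  have hrel : (fun c d : TConf A t => FH (Step A t) (SS (stk w f) l) c d ∧
      stk w f <:+ d.2.2) =
      fun c d => FH (Step A t) (SS (stk w f) l) c d ∧ d.1 = q ∧ d.2.2 = stk w f := by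
    funext c d
    apply propext
    refine and_congr_right fun h => ?_
    have h1 := h.target
    constructor
    · intro h2
      rcases h1 with h1 | ⟨h1, h3⟩
      · exact absurd h2 h1
      · exact ⟨(hl _).1 h3, h1⟩
    · rintro ⟨h2, h3⟩
      rw [h3]
  unfold Reach KK
  rw [FH.reach_iff (S := SS (stk w f) l) (I := fun d : TConf A t => stk w f <:+ d.2.2)
    (fun c hc => by by_contra h; exact hc (Or.inl h)) (Or.inr ⟨rfl, (hl q).2 rfl⟩), hrel,
    rtg_tuple]
  constructor
  · rintro (h | ⟨c, d, g1, g2, h⟩)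
    · simp only [Prod.mk.injEq, and_true] at h; exact Or.inl h
    · simp only [Prod.mk.injEq, and_true, true_and] at h; subst h
      exact Or.inr ⟨c, g1, g2⟩
  · rintro (⟨rfl, rfl⟩ | ⟨c, g1, g2⟩)
    · exact Or.inl rfl
    · exact Or.inr ⟨c, b, g1, g2, rfl⟩

theorem suffix_step {A : TWA Sig rank k} {t : RTree Sig rank} {c d : TConf A t} {y π}
    (h : Step A t c d) (h1 : y :: π <:+ c.2.2) (h2 : π <:+ d.2.2) :
    y :: π <:+ d.2.2 ∨
    (c.2.2 = y :: π ∧ d.2.2 = π ∧ d.2.1 = c.2.1 ∧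
      (c.1, TInstr.retrieve y.1, d.1) ∈ A.instr) := by
  obtain ⟨p, a, s⟩ := c
  obtain ⟨q, b, s'⟩ := d
  obtain ⟨ins, hi, hs⟩ := h
  simp only at *
  cases ins with
  | up i => obtain ⟨rfl, -⟩ := hs; exact Or.inl h1
  | down i j => obtain ⟨rfl, -⟩ := hs; exact Or.inl h1
  | test b τ => obtain ⟨-, rfl, -⟩ := hs; exact Or.inl h1
  | dropPeb i x => obtain ⟨-, rfl, -⟩ := hs; exact Or.inl (h1.trans (List.suffix_cons _ _))
  | retrieve x =>
    obtain ⟨rfl, w, rfl⟩ := hs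
    rcases List.suffix_cons_iff.1 h1 with h1 | h1
    · obtain ⟨rfl, rfl⟩ := List.cons.inj h1
      exact Or.inr ⟨rfl, rfl, rfl, hi⟩
    · exact Or.inl h1

theorem FH_nested {A : TWA Sig rank k} {t : RTree Sig rank} {y} {π : List (A.X × Pos t)}
    {c : TConf A t} {q b} (hc : y :: π <:+ c.2.2) :
    FH (Step A t) (SS π []) c (q, b, π) ↔
    ∃ q', (q', TInstr.retrieve y.1, q) ∈ A.instr ∧
      Relation.ReflTransGen (fun c d : TConf A t => Step A t c d ∧ y :: π <:+ d.2.2)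
        c (q', b, y :: π) := by
  have hlong : ∀ {s : List (A.X × Pos t)}, y :: π <:+ s → ¬ (¬ π <:+ s ∨ s = π) := by
    rintro s h (h' | rfl)
    · exact h' ((List.suffix_cons _ _).trans h)
    · have := h.length_le
      simp at this
  constructor
  · intro h
    generalize hd : ((q, b, π) : TConf A t) = d at h
    induction h with
    | @one c d h1 h2 =>
      subst hd
      rcases suffix_step h1 hc (List.suffix_refl _) with h | ⟨g1, g2, g3, g4⟩
      · exact absurd (Or.inr rfl) (hlong h)
      · refine ⟨c.1, g4, ?_⟩
        have : c = (c.1, b, y :: π) := by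
          obtain ⟨p, a, s⟩ := c
          simp only at *
          rw [g1, g3]
        rw [← this]
    | @cons c e d h1 h2 h3 ih =>
      simp only [SS, List.not_mem_nil, not_false_eq_true, and_true, not_or, not_not] at h2
      rcases suffix_step h1 hc h2.1 with h | ⟨g1, g2, g3, g4⟩
      · obtain ⟨q', k1, k2⟩ := ih h hd
        exact ⟨q', k1, .head ⟨h1, h⟩ k2⟩
      · exact absurd g2 h2.2
  · rintro ⟨q', h1, h2⟩
    induction h2 using Relation.ReflTransGen.head_induction_on with
    | refl => exact .one ⟨_, h1, rfl, y.2, rfl⟩ (Or.inr ⟨rfl, by simp⟩)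
    | head g1 _ ih =>
      refine .cons g1.1 ?_ (ih g1.2)
      have := hlong g1.2
      simpa [SS] using this

open Classical in
theorem KK_nil {A : TWA Sig rank k} {w p q} {t f a b} :
    KK A w [] p q t f a b ↔
      (∃ i ∈ A.instr, (i.1 = p ∧ i.2.2 = q) ∧ instrStep t i.2.1 a (stk w f) b (stk w f)) ∨
      ∃ x ∈ {x | x ∉ w}, ∃ i ∈ Set.univ, ∃ p' ∈ {p' | (p, TInstr.dropPeb i x, p') ∈ A.instr},
        ∃ q' ∈ {q' | (q', TInstr.retrieve x, q) ∈ A.instr},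
          Reach A (x :: w) p' q' t (fun y => if y = x then a i else f y) a b := by
  have hstk : ∀ x i, x ∉ w → stk (x :: w) (fun y => if y = x then a i else f y) =
      (x, a i) :: stk w f := by
    intro x i hx
    unfold stk
    simp only [List.map_cons, if_true]
    congr 1
    apply List.map_congr_left
    intro y hy
    rw [if_neg (by rintro rfl; exact hx hy)]
  have hmem : ∀ x, (∀ u, (x, u) ∉ stk w f) ↔ x ∉ w := by
    intro x
    unfold stk
    simp only [List.mem_map, Prod.mk.injEq, not_exists, not_and]
    constructor
    · intro h hx; exact h (f x) x hx rfl rfl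
    · rintro h u x' hx' rfl; exact absurd hx' h
  unfold KK
  constructor
  · intro h
    cases h with
    | one h1 h2 =>
      obtain ⟨ins, hi, hs⟩ := h1
      exact Or.inl ⟨_, hi, ⟨rfl, rfl⟩, hs⟩
    | @cons _ e _ h1 h2 h3 =>
      right
      obtain ⟨p', a', s⟩ := e
      obtain ⟨ins, hi, hs⟩ := h1
      simp only [SS, List.not_mem_nil, not_false_eq_true, and_true, not_or, not_not] at h2
      simp only at hi hs
      cases ins with
      | up i => exact absurd hs.1 h2.2
      | down i j => exact absurd hs.1 h2.2
      | test b τ => exact absurd hs.2.1 h2.2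
      | retrieve x =>
        obtain ⟨-, u, hu⟩ := hs
        have := h2.1.length_le
        rw [hu] at this
        simp at this
      | dropPeb i x =>
        obtain ⟨rfl, rfl, hx⟩ := hs
        rw [hmem] at hx
        rw [FH_nested (List.suffix_refl _)] at h3
        obtain ⟨q', k1, k2⟩ := h3
        refine ⟨x, hx, i, trivial, p', hi, q', k1, ?_⟩
        unfold Reach
        rw [hstk x i hx]
        exact k2
  · rintro (⟨⟨p', ins, q'⟩, hi, ⟨rfl, rfl⟩, hs⟩ | ⟨x, hx, i, -, p', hp', q', hq', h⟩)
    · exact .one ⟨ins, hi, hs⟩ (Or.inr ⟨rfl, by simp⟩)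
    · unfold Reach at h
      rw [hstk x i hx] at h
      refine .cons (e := (p', a, (x, a i) :: stk w f))
        ⟨_, hp', rfl, rfl, (hmem x).2 hx⟩ ?_ ?_
      · simp only [SS, List.not_mem_nil, not_false_eq_true, and_true, not_or, not_not]
        refine ⟨List.suffix_cons _ _, fun h => ?_⟩
        have := congrArg List.length h
        simp at this
      · rw [FH_nested (List.suffix_refl _)]
        exact ⟨q', hq', h⟩

theorem dfn_test {X : Type} [Finite X] (w : List X) (τ : TTest Sig k X) :
    DfnR (fun (t : RTree Sig rank) (f : X → Pos t) (a _ : Fin k → Pos t) =>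
      testHolds t τ a (stk w f)) := by
  cases τ with
  | lab i s => exact Dfn.lab s (Sum.inr (Sum.inl i))
  | chno i j => exact Dfn.chno (Sum.inr (Sum.inl i)) j
  | peb i x =>
    refine ((Dfn.const (x ∈ w)).and (Dfn.eq (Sum.inl x) (Sum.inr (Sum.inl i)))).congr
      fun t f => ?_
    simp only [testHolds, stk, List.mem_map, Prod.mk.injEq]
    constructor
    · rintro ⟨y, hy, rfl, h⟩; exact ⟨hy, h⟩
    · rintro ⟨h1, h2⟩; exact ⟨x, h1, rfl, h2⟩

theorem dfn_same {X : Type} :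
    DfnR (fun (t : RTree Sig rank) (_ : X → Pos t) (a b : Fin k → Pos t) => b = a) := by
  refine (Dfn.allFin (Set.finite_univ (α := Fin k)) (fun i _ =>
    Dfn.eq (Sum.inr (Sum.inr i)) (Sum.inr (Sum.inl i)))).congr fun t f => ?_
  simp [funext_iff]

theorem dfn_others {X : Type} (i : Fin k) :
    DfnR (fun (t : RTree Sig rank) (_ : X → Pos t) (a b : Fin k → Pos t) =>
      ∀ h, h ≠ i → b h = a h) := by
  refine (Dfn.allFin (Set.toFinite {h : Fin k | h ≠ i}) (fun i _ =>
    Dfn.eq (Sum.inr (Sum.inr i)) (Sum.inr (Sum.inl i)))).congr fun t f => Iff.rfl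

theorem dfn_instr {X : Type} [Finite X] (w : List X) (ins : TInstr Sig k X) :
    DfnR (fun (t : RTree Sig rank) (f : X → Pos t) (a b : Fin k → Pos t) =>
      instrStep t ins a (stk w f) b (stk w f)) := by
  cases ins with
  | up i =>
    refine ((Dfn.parent (Sum.inr (Sum.inl i)) (Sum.inr (Sum.inr i))).and
      (dfn_others i)).congr fun t f => ?_
    simp only [instrStep, true_and]
  | down i j =>
    refine ((Dfn.edg j (Sum.inr (Sum.inl i)) (Sum.inr (Sum.inr i))).and
      (dfn_others i)).congr fun t f => ?_
    simp only [instrStep, true_and, and_assoc]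
  | dropPeb i x =>
    refine (Dfn.const False).congr fun t f => ?_
    simp only [instrStep, iff_false]
    rintro ⟨-, h, -⟩
    have := congrArg List.length h
    simp at this
  | retrieve x =>
    refine (Dfn.const False).congr fun t f => ?_
    simp only [instrStep, iff_false]
    rintro ⟨-, u, h⟩
    have := congrArg List.length h
    simp at this
  | test b τ =>
    cases b with
    | true =>
      refine (dfn_same.and (dfn_test w τ)).congr fun t f => ?_
      simp only [instrStep, true_and, iff_true]
    | false =>
      refine (dfn_same.and (dfn_test w τ).not).congr fun t f => ?_
      simp [instrStep]

theorem dfn_KK {A : TWA Sig rank k} (hA : Deterministic A) [Finite A.X] (w : List A.X)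
    (h0 : ∀ p q, DfnR (KK A w [] p q)) (l : List A.Q) :
    ∀ p q, q ∉ l → DfnR (KK A w l p q) := by
  induction l with
  | nil => exact fun p q _ => h0 p q
  | cons m l ih =>
    intro p q hq
    have hql : q ∉ l := fun h => hq (List.mem_cons_of_mem _ h)
    by_cases hm : m ∈ l
    · refine (ih p q hql).congr fun t f a b => ?_
      refine FH.congr fun c => ?_
      have : ∀ x, x ∈ m :: l ↔ x ∈ l := by
        intro x; simp only [List.mem_cons, or_iff_right_iff_imp]; rintro rfl; exact hm
      simp only [SS, this]
    · refine (Dfn.or (ih p q hql) (DfnR.comp (ih p m hm) (DfnR.comp (DfnR.star (ih m m hm)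
        (fun t f a b b' => KK_functional hA)) (ih m q hql)))).congr fun t g => ?_
      exact KK_cons hm hq

theorem dfn_Reach_step {A : TWA Sig rank k} (hA : Deterministic A) [Finite A.X] [Finite A.Q]
    (w : List A.X) (hw : ∀ x, x ∉ w → ∀ p q, DfnR (Reach A (x :: w) p q)) (p q : A.Q) :
    DfnR (Reach A w p q) := by
  classical
  have h0 : ∀ p q, DfnR (KK A w [] p q) := by
    intro p q
    refine (Dfn.or
      (Dfn.exFin A.instrFin (fun i _ => (Dfn.const (i.1 = p ∧ i.2.2 = q)).and
        (dfn_instr w i.2.1)))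
      (Dfn.exFin (Set.toFinite {x | x ∉ w}) (fun x hx =>
        Dfn.exFin (Set.finite_univ (α := Fin k)) (fun i _ =>
        Dfn.exFin (Set.toFinite {p' | (p, TInstr.dropPeb i x, p') ∈ A.instr}) (fun p' _ =>
        Dfn.exFin (Set.toFinite {q' | (q', TInstr.retrieve x, q) ∈ A.instr}) (fun q' _ =>
          Dfn.reindex (hw x hx p' q') (κ := A.X ⊕ (Fin k ⊕ Fin k))
            (Sum.elim (fun y => if y = x then Sum.inr (Sum.inl i) else Sum.inl y)
              Sum.inr))))))).congr fun t g => ?_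
    rw [KK_nil]
    simp only [Sum.elim_inl, Sum.elim_inr, apply_ite g]
  obtain ⟨l, hl⟩ : ∃ l : List A.Q, ∀ r, r ∉ l ↔ r = q := by
    refine ⟨(Set.toFinite {r : A.Q | r ≠ q}).toFinset.toList, fun r => ?_⟩
    simp
  have hK := fun p => dfn_KK hA w h0 l p q ((hl q).2 rfl)
  refine (Dfn.or ((Dfn.const (p = q)).and dfn_same) (DfnR.comp (hK p) (DfnR.star (hK q)
    (fun t f a b b' => KK_functional hA)))).congr fun t g => ?_
  rw [Reach_iff hl]
  simp only [eq_comm (a := fun i => g (Sum.inr (Sum.inl i)))]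

theorem dfn_Reach {A : TWA Sig rank k} (hA : Deterministic A) [Fintype A.X] [Finite A.Q]
    (n : ℕ) : ∀ w : List A.X, w.Nodup → Fintype.card A.X ≤ w.length + n →
    ∀ p q, DfnR (Reach A w p q) := by
  induction n with
  | zero =>
    intro w hw hc
    refine dfn_Reach_step hA w fun x hx => ?_
    have := (List.nodup_cons.2 ⟨hx, hw⟩).length_le_card
    simp at this
    omega
  | succ n ih =>
    intro w hw hc
    refine dfn_Reach_step hA w fun x hx => ih (x :: w) (List.nodup_cons.2 ⟨hx, hw⟩) ?_
    simp only [List.length_cons]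
    omega

/-- Executability of an instruction on the empty pebble stack is definable. -/
theorem dfn_enabled {X : Type} [Finite X] (ins : TInstr Sig k X) :
    DfnR (fun (t : RTree Sig rank) (_ : X → Pos t) (a _ : Fin k → Pos t) =>
      ∃ b π, instrStep t ins a [] b π) := by
  have main : (∀ (t : RTree Sig rank) (a b : Fin k → Pos t) π,
      instrStep t ins a [] b π → π = []) →
      DfnR (fun (t : RTree Sig rank) (_ : X → Pos t) (a _ : Fin k → Pos t) =>
        ∃ b π, instrStep t ins a [] b π) := by
    intro hπ
    refine (DfnR.comp (dfn_instr (X := X) [] ins)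
      (R' := fun _ _ _ _ => True) (Dfn.const True)).congr fun t f a b => ?_
    refine exists_congr fun c => ?_
    constructor
    · rintro ⟨π, h⟩
      obtain rfl := hπ _ _ _ _ h
      exact ⟨h, trivial⟩
    · rintro ⟨h, -⟩
      exact ⟨[], h⟩
  cases ins with
  | up i => exact main fun t a b π h => h.1
  | down i j => exact main fun t a b π h => h.1
  | test b τ => exact main fun t a b π h => h.2.1
  | retrieve x => exact main fun t a b π h => by obtain ⟨-, w, h⟩ := h; simp at h
  | dropPeb i x =>
    refine (Dfn.const True).congr fun t f => ?_
    simp only [iff_true]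
    exact ⟨_, _, rfl, rfl, by simp⟩

theorem dfn_halting (A : TWA Sig rank k) [Finite A.X] (q : A.Q) :
    DfnR (fun (t : RTree Sig rank) (_ : A.X → Pos t) (a _ : Fin k → Pos t) =>
      HaltingConf A t (q, a, [])) := by
  refine (Dfn.exFin A.instrFin (fun i _ => (Dfn.const (i.1 = q)).and
    (dfn_enabled i.2.1))).not.congr fun t f => ?_
  simp only [HaltingConf, Step]
  constructor
  · rintro h ⟨⟨q', ins, r⟩, hi, rfl, b, π, hs⟩
    exact h (r, b, π) ⟨ins, hi, hs⟩
  · rintro h ⟨r, b, π⟩ ⟨ins, hi, hs⟩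
    exact h ⟨_, hi, rfl, b, π, hs⟩

end Automaton


/-- `DPTWA^k ⊆ FO+DTC^k`: every tree language accepted by a
deterministic `k`-head tree-walking automaton with nested pebbles is definable in
first-order logic with `k`-ary deterministic transitive closure. -/
theorem DPTWA_subset_FODTC (Sig : Type) [Fintype Sig] (rank : Sig → ℕ)
    (k : ℕ) (hk : 1 ≤ k) :
    DPTWA Sig rank k ⊆ FODTC Sig rank k := by
  rintro L ⟨A, hA, rfl⟩
  haveI := A.finQ
  haveI := A.finX
  have h1 : Dfn k (fun (t : RTree Sig rank) (f : Option Empty → Pos t) =>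
      f none = rootPos t ∧ ∃ q ∈ A.acc,
        Reach A [] A.q0 q t (fun _ => f none) (fun _ => f none) (fun _ => f none) ∧
        HaltingConf A t (q, fun _ => f none, [])) :=
    (Dfn.root none).and (Dfn.exFin (Set.toFinite A.acc) (fun q _ =>
      (Dfn.reindex (dfn_Reach hA (Fintype.card A.X) [] List.nodup_nil (by simp) A.q0 q)
        (fun _ => none)).and (Dfn.reindex (dfn_halting A q) (fun _ => none))))
  obtain ⟨φ, g1, g2, g3, g4⟩ := h1.ex Empty.elim
  refine ⟨φ, g1, g2, ?_, ?_⟩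
  · rw [Set.range_eq_empty] at g3
    exact Set.subset_empty_iff.1 g3
  · ext t
    simp only [treesOf, Set.mem_setOf_eq, g4, Lang, Accepts, Option.elim]
    have hR : ∀ q (u : Pos t), Reach A [] A.q0 q t (fun _ => u) (fun _ => u) (fun _ => u) ↔
        Relation.ReflTransGen (Step A t) (A.q0, fun _ => u, []) (q, fun _ => u, []) := by
      intro q u
      simp [Reach, stk]
    simp only [hR]
    constructor
    · rintro ⟨q, hq, h⟩
      exact ⟨rootPos t, rfl, q, hq, h⟩
    · rintro ⟨_, rfl, q, hq, h⟩
      exact ⟨q, hq, h⟩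

end NestedPebbles
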